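/- Let k ⊂ k_r be finite fields with |k| = q and [k_r : k] = r, ψ a nontrivial additive character of k, m ≥ 1, and n = mr. Then for every λ ∈ k^×: Σ_{x ∈ k_r^×, N_{k_r/k}(x) = λ} K_{m,x}(ψ ∘ Tr_{k_r/k}) = (-1)^{n - m} K_{n, λ}(ψ), where K_{m,x}(ψ') = Σ_{ζ_1⋯ζ_m = x, ζ_i ∈ k_r^×} ψ'(ζ_1 + ⋯ + ζ_m) and similarly for K_{n,λ}(ψ) over k. -/

import Mathlib

open Finset

/-- The generalized Kloosterman sum `K_{n,a}(ψ)`, the sum of `ψ(ζ₁ + ⋯ + ζₙ)`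
over `n`-tuples `(ζ₁, …, ζₙ)` of elements of `kˣ` with product `a`. -/
noncomputable def kloosterman {k : Type*} [Field k] [Fintype k] [DecidableEq k]
    (ψ : k → ℂ) (n : ℕ) (a : kˣ) : ℂ :=
  ∑ ζ ∈ Finset.univ.filter (fun ζ : Fin n → kˣ => (∏ i, ((ζ i : k))) = (a : k)),
    ψ (∑ i, ((ζ i : k)))

open Polynomial UniqueFactorizationMonoid

section HasseDavenport

variable {F A : Type*} [Field F] [CommRing A]

/-- The multiplicative weight `χ (±f(0)) ψ (-f_{n-1})` of a polynomial `f` of degree `n`. For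
the characteristic polynomial of an element of an extension of `F`, this is the product
of `χ` of its norm and `ψ` of its trace. -/
noncomputable def gaussWeight (χ : MulChar F A) (ψ : AddChar F A) (f : F[X]) : A :=
  χ ((-1) ^ f.natDegree * f.coeff 0) * ψ (-f.nextCoeff)

lemma gaussWeight_one (χ : MulChar F A) (ψ : AddChar F A) : gaussWeight χ ψ 1 = 1 := by
  have h : (1 : F[X]).nextCoeff = 0 := by simp [nextCoeff]
  simp [gaussWeight, h]

lemma gaussWeight_mul (χ : MulChar F A) (ψ : AddChar F A) {f g : F[X]} (hf : f.Monic)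
    (hg : g.Monic) : gaussWeight χ ψ (f * g) = gaussWeight χ ψ f * gaussWeight χ ψ g := by
  have h : (-1 : F) ^ (f.natDegree + g.natDegree) * (f.coeff 0 * g.coeff 0) =
      ((-1) ^ f.natDegree * f.coeff 0) * ((-1) ^ g.natDegree * g.coeff 0) := by ring
  simp only [gaussWeight, hf.natDegree_mul hg, mul_coeff_zero, hf.nextCoeff_mul hg, neg_add,
    AddChar.map_add_eq_mul, h, map_mul]
  ring

lemma gaussWeight_pow (χ : MulChar F A) (ψ : AddChar F A) {f : F[X]} (hf : f.Monic) (k : ℕ) :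
    gaussWeight χ ψ (f ^ k) = gaussWeight χ ψ f ^ k := by
  induction k with
  | zero => simp [gaussWeight_one]
  | succ k ih => rw [pow_succ, gaussWeight_mul χ ψ (hf.pow k) hf, ih, pow_succ]

lemma gaussWeight_X_sub_C (χ : MulChar F A) (ψ : AddChar F A) (a : F) :
    gaussWeight χ ψ (X - C a) = χ a * ψ a := by
  simp [gaussWeight, nextCoeff_X_sub_C]

lemma gaussWeight_minpoly_pow {E : Type*} [Field E] [Algebra F E] [FiniteDimensional F E]
    (χ : MulChar F A) (ψ : AddChar F A) (y : E) {k : ℕ}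
    (hk : k * (minpoly F y).natDegree = Module.finrank F E) :
    gaussWeight χ ψ (minpoly F y) ^ k = χ (Algebra.norm F y) * ψ (Algebra.trace F E y) := by
  have hy : IsIntegral F y := .of_finite F y
  have hk' : k = Module.finrank (IntermediateField.adjoin F {y}) E := by
    have := Module.finrank_mul_finrank F (IntermediateField.adjoin F {y}) E
    rw [IntermediateField.adjoin.finrank hy, ← hk, mul_comm] at this
    exact (Nat.eq_of_mul_eq_mul_right (minpoly.natDegree_pos hy) this).symm
  have hN := Algebra.PowerBasis.norm_gen_eq_coeff_zero_minpoly
    (IntermediateField.adjoin.powerBasis hy)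
  rw [IntermediateField.adjoin.powerBasis_gen, IntermediateField.adjoin.powerBasis_dim,
    IntermediateField.minpoly_gen] at hN
  rw [Algebra.norm_eq_norm_adjoin, trace_eq_finrank_mul_minpoly_nextCoeff, hN, ← hk', map_pow,
    ← nsmul_eq_mul, AddChar.map_nsmul_eq_pow, ← mul_pow, gaussWeight]

section Finite

variable [Finite F]

variable (F) in
lemma finite_setOf_monic_natDegree_eq (n : ℕ) : {f : F[X] | f.Monic ∧ f.natDegree = n}.Finite := by
  refine Set.Finite.of_injOn (f := fun f (i : Fin (n + 1)) => f.coeff i) (t := Set.univ)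
    (fun _ _ => Set.mem_univ _) ?_ Set.finite_univ
  intro f hf g hg h
  refine (ext_iff_natDegree_le hf.2.le hg.2.le).mpr fun i hi => ?_
  exact congrFun h ⟨i, by omega⟩

variable (F) in
/-- The monic polynomials of degree `n` over a finite field. -/
noncomputable def monicOfDegree (n : ℕ) : Finset F[X] :=
  (finite_setOf_monic_natDegree_eq F n).toFinset

lemma mem_monicOfDegree {n : ℕ} {f : F[X]} :
    f ∈ monicOfDegree F n ↔ f.Monic ∧ f.natDegree = n := by
  simp [monicOfDegree]

/-- The sum of the weights of the monic polynomials of degree `n`. -/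
noncomputable def gaussWeightSum (χ : MulChar F A) (ψ : AddChar F A) (n : ℕ) : A :=
  ∑ f ∈ monicOfDegree F n, gaussWeight χ ψ f

lemma gaussWeightSum_zero (χ : MulChar F A) (ψ : AddChar F A) : gaussWeightSum χ ψ 0 = 1 := by
  have : monicOfDegree F 0 = {1} := by
    ext f
    rw [mem_monicOfDegree, mem_singleton]
    exact ⟨fun h => (Monic.natDegree_eq_zero h.1).mp h.2, by rintro rfl; simp⟩
  rw [gaussWeightSum, this, sum_singleton, gaussWeight_one]

lemma gaussWeightSum_eq_zero (χ : MulChar F A) {ψ : AddChar F A} {c : F}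
    (hc : IsUnit (ψ c - 1)) {n : ℕ} (hn : 2 ≤ n) : gaussWeightSum χ ψ n = 0 := by
  have hdeg {f : F[X]} (hf : f.Monic) (hfn : f.natDegree = n) (b : F) :
      (C b * X ^ (n - 1)).degree < f.degree := by
    refine (degree_C_mul_X_pow_le _ _).trans_lt ?_
    rw [degree_eq_natDegree hf.ne_zero, hfn]
    exact_mod_cast (by omega : n - 1 < n)
  have hmem (b : F) (f : F[X]) (hf : f ∈ monicOfDegree F n) :
      f + C b * X ^ (n - 1) ∈ monicOfDegree F n := by
    rw [mem_monicOfDegree] at hf ⊢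
    have h := hdeg hf.1 hf.2 b
    exact ⟨hf.1.add_of_left h, by rw [natDegree_add_eq_left_of_degree_lt h, hf.2]⟩
  have key : gaussWeightSum χ ψ n = ψ c * gaussWeightSum χ ψ n := by
    rw [gaussWeightSum, mul_sum]
    refine (sum_bij' (fun f _ => f + C (-c) * X ^ (n - 1)) (fun f _ => f + C c * X ^ (n - 1))
      (hmem (-c)) (hmem c) (by simp) (by simp) fun f hf => ?_).symm
    have hf' := mem_monicOfDegree.mp hf
    have hg := mem_monicOfDegree.mp (hmem (-c) f hf)
    simp only [gaussWeight]
    rw [nextCoeff_of_natDegree_pos (by omega), nextCoeff_of_natDegree_pos (by omega), hg.2, hf'.2,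
      coeff_add, coeff_add, coeff_C_mul_X_pow, coeff_C_mul_X_pow, if_neg (by omega), if_pos rfl,
      add_zero, neg_add, neg_neg, AddChar.map_add_eq_mul]
    ring
  have h0 : (ψ c - 1) * gaussWeightSum χ ψ n = 0 := by linear_combination -key
  exact hc.mul_right_eq_zero.mp h0

lemma sum_gaussWeight_filter_dvd (χ : MulChar F A) (ψ : AddChar F A) {g : F[X]} (hg : g.Monic)
    {n : ℕ} [DecidablePred (g ∣ ·)] :
    ∑ f ∈ monicOfDegree F n with g ∣ f, gaussWeight χ ψ f =
      if g.natDegree ≤ n then gaussWeight χ ψ g * gaussWeightSum χ ψ (n - g.natDegree) else 0 := by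
  split_ifs with h
  · rw [gaussWeightSum, mul_sum]
    symm
    refine sum_nbij (g * ·) ?_ ?_ ?_ ?_
    · intro f hf
      have hf := mem_monicOfDegree.mp hf
      simp only [mem_filter, mem_monicOfDegree, dvd_mul_right, and_true]
      exact ⟨hg.mul hf.1, by rw [hg.natDegree_mul hf.1, hf.2]; omega⟩
    · exact fun f _ f' _ h => mul_left_cancel₀ hg.ne_zero h
    · rintro f hf
      simp only [coe_filter, mem_monicOfDegree, Set.mem_ofPred_eq] at hf
      obtain ⟨⟨hm, hd⟩, f, rfl⟩ := hf
      have hf := hg.of_mul_monic_left hm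
      rw [hg.natDegree_mul hf] at hd
      exact ⟨f, mem_monicOfDegree.mpr ⟨hf, by omega⟩, rfl⟩
    · exact fun f hf => (gaussWeight_mul χ ψ hg (mem_monicOfDegree.mp hf).1).symm
  · refine sum_eq_zero fun f hf => absurd ?_ h
    simp only [mem_filter, mem_monicOfDegree] at hf
    exact (natDegree_le_of_dvd hf.2 hf.1.1.ne_zero).trans hf.1.2.le

variable (F) in
open Classical in
/-- The pairs `(P, k)` of a monic irreducible polynomial `P` of degree at most `N` and an exponent
`1 ≤ k ≤ N`. -/
noncomputable def monicPrimePowers (N : ℕ) : Finset (F[X] × ℕ) :=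
  {P ∈ (Icc 1 N).biUnion (monicOfDegree F) | Irreducible P} ×ˢ Icc 1 N

lemma mem_monicPrimePowers {N : ℕ} {p : F[X] × ℕ} :
    p ∈ monicPrimePowers F N ↔
      (p.1.Monic ∧ Irreducible p.1 ∧ p.1.natDegree ≤ N) ∧ 1 ≤ p.2 ∧ p.2 ≤ N := by
  simp only [monicPrimePowers, mem_product, mem_filter, mem_biUnion, mem_Icc, mem_monicOfDegree]
  constructor
  · rintro ⟨⟨⟨d, hd, hm, rfl⟩, hi⟩, hk⟩
    exact ⟨⟨hm, hi, hd.2⟩, hk⟩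
  · rintro ⟨⟨hm, hi, hd⟩, hk⟩
    exact ⟨⟨⟨_, ⟨hi.natDegree_pos, hd⟩, hm, rfl⟩, hi⟩, hk⟩

open Classical in
lemma natDegree_eq_sum_monicPrimePowers {N : ℕ} {f : F[X]} (hf : f.Monic) (hN : f.natDegree ≤ N) :
    f.natDegree = ∑ p ∈ monicPrimePowers F N with p.1 ^ p.2 ∣ f, p.1.natDegree := by
  have hmem {P : F[X]} : P ∈ normalizedFactors f ↔ Irreducible P ∧ P.Monic ∧ P ∣ f :=
    Polynomial.mem_normalizedFactors_iff hf.ne_zero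
  have hprod : (normalizedFactors f).prod = f := by
    rw [prod_normalizedFactors_eq hf.ne_zero, hf.normalize_eq_self]
  have hcount {P : F[X]} (hP : Irreducible P) (hm : P.Monic) (k : ℕ) :
      P ^ k ∣ f ↔ k ≤ (normalizedFactors f).count P := by
    rw [pow_dvd_iff_le_emultiplicity, emultiplicity_eq_count_normalizedFactors hP hf.ne_zero,
      hm.normalize_eq_self, Nat.cast_le]
  conv_lhs => rw [← hprod, natDegree_multiset_prod_of_monic _ fun P hP => (hmem.mp hP).2.1,
    sum_multiset_map_count]
  rw [sum_filter, monicPrimePowers, sum_product]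
  simp only [smul_eq_mul]
  refine sum_subset_zero_on_sdiff (fun P hP => ?_) (fun P hP => ?_) fun P hP => ?_
  · obtain ⟨hi, hm, hd⟩ := hmem.mp (Multiset.mem_toFinset.mp hP)
    simp only [mem_filter, mem_biUnion, mem_Icc, mem_monicOfDegree]
    exact ⟨⟨_, ⟨hi.natDegree_pos, (natDegree_le_of_dvd hd hf.ne_zero).trans hN⟩, hm, rfl⟩, hi⟩
  · simp only [mem_sdiff, Multiset.mem_toFinset, mem_filter, mem_biUnion, mem_monicOfDegree] at hP
    obtain ⟨⟨⟨d, -, hm, -⟩, hi⟩, hP⟩ := hP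
    refine sum_eq_zero fun k hk => if_neg fun h => hP (hmem.mpr ⟨hi, hm, ?_⟩)
    exact (dvd_pow_self P (by have := (mem_Icc.mp hk).1; omega)).trans h
  · obtain ⟨hi, hm, hd⟩ := hmem.mp (Multiset.mem_toFinset.mp hP)
    have hle : (normalizedFactors f).count P ≤ N := by
      have h := natDegree_le_of_dvd ((hcount hi hm _).mpr le_rfl) hf.ne_zero
      rw [hm.natDegree_pow] at h
      exact (Nat.le_mul_of_pos_right _ hi.natDegree_pos).trans (h.trans hN)
    have : {k ∈ Icc 1 N | P ^ k ∣ f} = Icc 1 ((normalizedFactors f).count P) := by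
      ext k
      simp only [mem_filter, mem_Icc, hcount hi hm]
      omega
    rw [← sum_filter, this, sum_const, Nat.card_Icc, Nat.add_sub_cancel, smul_eq_mul]

/-- The coefficients of the logarithmic derivative of the Euler product of the weights,
with polynomials up to degree `N` taken into account. -/
noncomputable def gaussPrimePowerSum (χ : MulChar F A) (ψ : AddChar F A) (N j : ℕ) : A :=
  ∑ p ∈ monicPrimePowers F N with p.2 * p.1.natDegree = j,
    (p.1.natDegree : A) * gaussWeight χ ψ p.1 ^ p.2

lemma natCast_mul_gaussWeightSum (χ : MulChar F A) (ψ : AddChar F A) {N n : ℕ} (hn : n ≤ N) :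
    (n : A) * gaussWeightSum χ ψ n =
      ∑ j ∈ Icc 1 n, gaussPrimePowerSum χ ψ N j * gaussWeightSum χ ψ (n - j) := by
  classical
  calc (n : A) * gaussWeightSum χ ψ n
      = ∑ f ∈ monicOfDegree F n, ∑ p ∈ monicPrimePowers F N,
          if p.1 ^ p.2 ∣ f then (p.1.natDegree : A) * gaussWeight χ ψ f else 0 := by
        rw [gaussWeightSum, mul_sum]
        refine sum_congr rfl fun f hf => ?_
        obtain ⟨hm, rfl⟩ := mem_monicOfDegree.mp hf
        conv_lhs => rw [natDegree_eq_sum_monicPrimePowers hm hn]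
        rw [Nat.cast_sum, sum_mul, sum_filter]
    _ = ∑ p ∈ monicPrimePowers F N, if p.2 * p.1.natDegree ≤ n then (p.1.natDegree : A) *
          gaussWeight χ ψ p.1 ^ p.2 * gaussWeightSum χ ψ (n - p.2 * p.1.natDegree) else 0 := by
        rw [sum_comm]
        refine sum_congr rfl fun p hp => ?_
        have hm := (mem_monicPrimePowers.mp hp).1.1
        rw [← sum_filter, ← mul_sum, sum_gaussWeight_filter_dvd χ ψ (hm.pow _), hm.natDegree_pow,
          gaussWeight_pow χ ψ hm, mul_ite, mul_zero, mul_assoc]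
    _ = _ := by
        rw [← sum_filter, ← sum_fiberwise_of_maps_to (t := Icc 1 n)
          (g := fun p => p.2 * p.1.natDegree)]
        · refine sum_congr rfl fun j hj => ?_
          rw [gaussPrimePowerSum, sum_mul, filter_filter]
          refine sum_congr (filter_congr fun p _ => ?_) fun p hp => ?_
          · have := mem_Icc.mp hj
            omega
          · rw [(mem_filter.mp hp).2]
        · intro p hp
          obtain ⟨hp, h⟩ := mem_filter.mp hp
          obtain ⟨⟨-, hi, -⟩, hk, -⟩ := mem_monicPrimePowers.mp hp
          exact mem_Icc.mpr ⟨Nat.mul_pos hk hi.natDegree_pos, h⟩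

lemma gaussPrimePowerSum_succ (χ : MulChar F A) {ψ : AddChar F A} {c : F}
    (hc : IsUnit (ψ c - 1)) {N n : ℕ} (hn : n + 1 ≤ N) :
    gaussPrimePowerSum χ ψ N (n + 1) = (-1) ^ n * gaussWeightSum χ ψ 1 ^ (n + 1) := by
  induction n with
  | zero =>
    have := natCast_mul_gaussWeightSum χ ψ hn
    simpa [gaussWeightSum_zero] using this.symm
  | succ n ih =>
    have h := natCast_mul_gaussWeightSum χ ψ hn
    rw [gaussWeightSum_eq_zero χ hc (by omega), mul_zero, sum_Icc_succ_top (by omega),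
      sum_Icc_succ_top (by omega), sum_eq_zero, Nat.sub_self, gaussWeightSum_zero,
      show n + 1 + 1 - (n + 1) = 1 by omega, ih (by omega)] at h
    · linear_combination -h
    · intro j hj
      have := mem_Icc.mp hj
      rw [gaussWeightSum_eq_zero χ hc (by omega), mul_zero]

end Finite

variable [Fintype F]

lemma gaussWeightSum_one (χ : MulChar F A) (ψ : AddChar F A) :
    gaussWeightSum χ ψ 1 = gaussSum χ ψ := by
  rw [gaussWeightSum, gaussSum]
  symm
  refine sum_nbij (fun a => X - C a) (fun a _ => ?_) (fun a _ b _ h => ?_) (fun f hf => ?_)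
    fun a _ => (gaussWeight_X_sub_C χ ψ a).symm
  · exact mem_monicOfDegree.mpr ⟨monic_X_sub_C a, natDegree_X_sub_C a⟩
  · simpa using h
  · obtain ⟨hm, hd⟩ := mem_monicOfDegree.mp hf
    refine ⟨-f.coeff 0, by simp, ?_⟩
    simpa using (hm.eq_X_add_C hd).symm

lemma card_filter_minpoly_eq {E : Type*} [Field E] [Fintype E] [Algebra F E] {P : F[X]}
    (hm : P.Monic) (hi : Irreducible P) (hd : P.natDegree ∣ Module.finrank F E)
    [DecidablePred fun y : E => minpoly F y = P] :
    #{y : E | minpoly F y = P} = P.natDegree := by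
  have hsplit : (P.map (algebraMap F E)).Splits := by
    refine (FiniteField.isSplittingField_sub E F).splits.of_dvd
      (map_ne_zero (FiniteField.X_pow_card_sub_X_ne_zero _ Fintype.one_lt_card))
      ((map_dvd_map' _).mpr ?_)
    rw [Module.card_eq_pow_finrank (K := F), Fintype.card_eq_nat_card]
    exact hi.natDegree_dvd_iff_dvd_X_pow_card_pow_sub_X.mp hd
  rw [← card_rootSet_eq_natDegree (PerfectField.separable_of_irreducible hi) hsplit,
    ← Set.toFinset_card]
  congr 1
  ext y
  simp only [mem_filter, mem_univ, true_and, Set.mem_toFinset, mem_rootSet]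
  constructor
  · rintro rfl
    exact ⟨hi.ne_zero, minpoly.aeval F y⟩
  · exact fun h => (minpoly.eq_of_irreducible_of_monic hi h.2 hm).symm

lemma gaussPrimePowerSum_finrank (E : Type*) [Field E] [Fintype E] [Algebra F E]
    (χ : MulChar F A) (ψ : AddChar F A) :
    gaussPrimePowerSum χ ψ (Module.finrank F E) (Module.finrank F E) =
      ∑ y : E, χ (Algebra.norm F y) * ψ (Algebra.trace F E y) := by
  classical
  have hdvd (y : E) : (minpoly F y).natDegree ∣ Module.finrank F E :=
    minpoly.degree_dvd (.of_finite F y)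
  rw [gaussPrimePowerSum, ← sum_fiberwise_of_maps_to (s := univ)
    (g := fun y : E => (minpoly F y, Module.finrank F E / (minpoly F y).natDegree))]
  · refine sum_congr rfl fun p hp => ?_
    obtain ⟨hp, hpr⟩ := mem_filter.mp hp
    obtain ⟨⟨hm, hi, -⟩, -⟩ := mem_monicPrimePowers.mp hp
    have hset : ({y : E | (minpoly F y, Module.finrank F E / (minpoly F y).natDegree) = p} :
        Finset E) = ({y : E | minpoly F y = p.1} : Finset E) := by
      refine filter_congr fun y _ => ⟨fun h => congrArg Prod.fst h, fun h => Prod.ext h ?_⟩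
      simp only [h]
      exact Nat.div_eq_of_eq_mul_left hi.natDegree_pos hpr.symm
    rw [hset, ← card_filter_minpoly_eq (E := E) hm hi (Dvd.intro_left _ hpr), ← nsmul_eq_mul,
      ← sum_const]
    refine sum_congr rfl fun y hy => ?_
    have hy := (mem_filter.mp hy).2
    rw [← hy] at hpr ⊢
    exact gaussWeight_minpoly_pow χ ψ y hpr
  · intro y _
    have hy : IsIntegral F y := .of_finite F y
    have hr : 0 < Module.finrank F E := Module.finrank_pos
    simp only [mem_filter, mem_monicPrimePowers]
    exact ⟨⟨⟨minpoly.monic hy, minpoly.irreducible hy, Nat.le_of_dvd hr (hdvd y)⟩,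
      Nat.div_pos (Nat.le_of_dvd hr (hdvd y)) (minpoly.natDegree_pos hy), Nat.div_le_self _ _⟩,
      Nat.div_mul_cancel (hdvd y)⟩

/-- The **Hasse-Davenport lifting relation** for Gauss sums with values in a commutative ring. -/
theorem sum_norm_mul_trace_eq_gaussSum_pow (E : Type*) [Field E] [Fintype E] [Algebra F E]
    (χ : MulChar F A) {ψ : AddChar F A} {c : F} (hc : IsUnit (ψ c - 1)) :
    ∑ y : E, χ (Algebra.norm F y) * ψ (Algebra.trace F E y) =
      (-1) ^ (Module.finrank F E - 1) * gaussSum χ ψ ^ Module.finrank F E := by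
  have hr : 0 < Module.finrank F E := Module.finrank_pos
  obtain ⟨n, hn⟩ := Nat.exists_eq_succ_of_ne_zero hr.ne'
  rw [← gaussPrimePowerSum_finrank, ← gaussWeightSum_one]
  have := gaussPrimePowerSum_succ χ hc (N := Module.finrank F E) (n := n) hn.ge
  rw [hn] at this ⊢
  simpa using this

end HasseDavenport

section MonoidAlgebra

variable {k E : Type*} [Field k] [DecidableEq k] [Field E] [Fintype E] [DecidableEq E]

/-- Powers of a sum in the group algebra of `kˣ` have Kloosterman sums as coefficients. -/
lemma coeff_sum_single_pow_eq_sum_kloosterman (ν : Eˣ →* kˣ) (φ : AddChar E ℂ) (m : ℕ) (l : kˣ) :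
    ((∑ y : Eˣ, MonoidAlgebra.single (ν y) (φ y)) ^ m).coeff l =
      ∑ x : Eˣ with ν x = l, kloosterman φ m x := by
  have h (ζ : Fin m → Eˣ) : ∏ i, MonoidAlgebra.single (ν (ζ i)) (φ (ζ i)) =
      MonoidAlgebra.single (ν (∏ i, ζ i)) (φ (∑ i, (ζ i : E))) := by
    have hφ : φ (∑ i, (ζ i : E)) = ∏ i, φ (ζ i) :=
      map_prod φ.toMonoidHom (fun i => Multiplicative.ofAdd (ζ i : E)) univ
    rw [MonoidAlgebra.prod_single, map_prod, hφ]
  simp only [Fintype.sum_pow, h, MonoidAlgebra.coeff_sum, MonoidAlgebra.coeff_single,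
    Finsupp.finsetSum_apply, Finsupp.single_apply]
  rw [← sum_filter, ← sum_fiberwise_of_maps_to (t := {x : Eˣ | ν x = l})
    (g := fun ζ : Fin m → Eˣ => ∏ i, ζ i) (by simp)]
  refine sum_congr rfl fun x hx => ?_
  rw [kloosterman, filter_filter]
  refine sum_congr (filter_congr fun ζ _ => ?_) fun _ _ => rfl
  rw [← Units.coe_prod, Units.val_inj]
  exact ⟨And.right, by rintro rfl; exact ⟨(mem_filter.mp hx).2, rfl⟩⟩

/-- The Hasse-Davenport relation in the group algebra of `kˣ`. -/
lemma sum_single_norm_eq_sum_single_pow [Fintype k] [Algebra k E] {ψ : AddChar k ℂ} (hψ : ψ ≠ 1) :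
    ∑ y : Eˣ, MonoidAlgebra.single (Units.map (Algebra.norm k) y) (ψ (Algebra.trace k E y)) =
      (-1) ^ (Module.finrank k E - 1) *
        (∑ a : kˣ, MonoidAlgebra.single a (ψ a)) ^ Module.finrank k E := by
  let χ : MulChar k (MonoidAlgebra ℂ kˣ) :=
    MulChar.ofUnitHom (MonoidAlgebra.of ℂ kˣ).toHomUnits
  let ψ' : AddChar k (MonoidAlgebra ℂ kˣ) :=
    (algebraMap ℂ (MonoidAlgebra ℂ kˣ) : ℂ →* MonoidAlgebra ℂ kˣ).compAddChar ψ
  have hχψ (u : kˣ) (t : k) : χ u * ψ' t = MonoidAlgebra.single u (ψ t) := by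
    simp [χ, ψ', MonoidAlgebra.single_mul_single]
  obtain ⟨c, hc⟩ := (AddChar.ne_one_iff).mp hψ
  have hu : IsUnit (ψ' c - 1) := by
    have : ψ' c - 1 = algebraMap ℂ (MonoidAlgebra ℂ kˣ) (ψ c - 1) := by
      rw [map_sub, map_one]; rfl
    rw [this]
    exact (sub_ne_zero.mpr hc).isUnit.map _
  have hE := sum_norm_mul_trace_eq_gaussSum_pow E χ hu
  have hk : gaussSum χ ψ' = ∑ a : kˣ, MonoidAlgebra.single a (ψ a) := by
    refine (Fintype.sum_of_injective _ Units.val_injective _ _ (fun a ha => ?_)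
      fun a => (hχψ a a).symm).symm
    rw [χ.map_nonunit ha, zero_mul]
  rw [← hk, ← hE]
  refine Fintype.sum_of_injective _ Units.val_injective _ _ (fun y hy => ?_)
    fun y => (hχψ (Units.map (Algebra.norm k) y) _).symm
  have hy : y = 0 := not_not.mp fun h => hy ⟨Units.mk0 y h, rfl⟩
  rw [hy, Algebra.norm_zero, χ.map_zero, zero_mul]

end MonoidAlgebra

/-- transitivity of generalized Kloosterman sums: for a degree-`r`
extension `kᵣ/k` and `n = m r`,
`∑_{x ∈ kᵣ^×, N(x) = l} K_{m,x}(ψ ∘ Tr) = (-1)^(n-m) K_{n,l}(ψ)`. -/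
theorem kloosterman_transitivity
    {k kr : Type*} [Field k] [Fintype k] [DecidableEq k]
    [Field kr] [Fintype kr] [DecidableEq kr] [Algebra k kr]
    (q r : ℕ) (hq : Fintype.card k = q) (hr : Module.finrank k kr = r)
    (ψ : AddChar k ℂ) (hψ : ψ ≠ 1)
    (m n : ℕ) (hm : 1 ≤ m) (hn : n = m * r) (l : kˣ) :
    ∑ x ∈ Finset.univ.filter (fun x : krˣ => Algebra.norm k (x : kr) = (l : k)),
        kloosterman (fun z : kr => ψ (Algebra.trace k kr z)) m x
      = (-1 : ℂ) ^ (n - m) * kloosterman (⇑ψ) n l := by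
  classical
  let φ : AddChar kr ℂ := ψ.compAddMonoidHom (Algebra.trace k kr).toAddMonoidHom
  have hl := coeff_sum_single_pow_eq_sum_kloosterman (Units.map (Algebra.norm k)) φ m l
  have hrhs := coeff_sum_single_pow_eq_sum_kloosterman (MonoidHom.id kˣ) ψ n l
  have hHD := sum_single_norm_eq_sum_single_pow (E := kr) hψ
  have hsign : (r - 1) * m = n - m := by rw [hn, Nat.sub_mul, one_mul, mul_comm]
  have hpow : (∑ y : krˣ, MonoidAlgebra.single (Units.map (Algebra.norm k) y) (φ y)) ^ m =
      (-1 : ℂ) ^ (n - m) • (∑ a : kˣ, MonoidAlgebra.single a (ψ a)) ^ n := by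
    refine (congrArg (· ^ m) hHD).trans ?_
    rw [hr, mul_pow, ← pow_mul, ← pow_mul, hsign, mul_comm r m, ← hn, Algebra.smul_def, map_pow,
      map_neg, map_one]
  rw [hpow] at hl
  simp only [MonoidHom.id_apply, sum_filter, sum_ite_eq', mem_univ, if_true] at hrhs
  rw [MonoidAlgebra.coeff_smul, Finsupp.smul_apply, hrhs, smul_eq_mul] at hl
  rw [hl]
  refine sum_congr (filter_congr fun x _ => ?_) fun _ _ => rfl
  rw [← Units.val_inj]
  rfl
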